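/- arXiv:1509.04955 — 2 statements merged into one kernel-verified Lean document; each statement's English description precedes it below -/
import Mathlib

section
/- Let ψ_1, ψ_2, ψ_3 be three distinct linear forms from the family Ψ (forms ψ_{v,I}(x,y) = Σ_{i∈I}(v−i)x_i + Σ_{i∉I}(v−i)y_i with v ∈ [k], I ⊆ [k], v ∈ I). If there exist nonzero reals c_1, c_2, c_3 with c_1 + c_2 + c_3 = 0 and c_1 ψ_1 + c_2 ψ_2 + c_3 ψ_3 = 0, then ψ_1, ψ_2, ψ_3 share a common set of variables; i.e., there exists I ⊆ [k] with I(ψ_j) = I ∪ {v(ψ_j)} for j = 1, 2, 3. -/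
/-- ψ_{v,I}(x,y) = Σ_{i∈I}(v−i)x_i + Σ_{i∉I}(v−i)y_i. -/
def psiVI (k : ℕ) (v : Fin k) (I : Finset (Fin k)) (x y : Fin k → ℝ) : ℝ :=
  ∑ i : Fin k, (if i ∈ I then ((v : ℝ) - (i : ℝ)) * x i else ((v : ℝ) - (i : ℝ)) * y i)

/-- The coefficient of `x i` in `ψ_{v,I}`. -/
theorem psiVI_single_zero (k : ℕ) (v : Fin k) (I : Finset (Fin k)) (i : Fin k) :
    psiVI k v I (Pi.single i 1) 0 = if i ∈ I then (v : ℝ) - (i : ℝ) else 0 := by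
  unfold psiVI
  rw [Finset.sum_eq_single i]
  · simp
  · intro b _ hb
    simp [hb]
  · simp

/-- The coefficient of `y i` in `ψ_{v,I}`. -/
theorem psiVI_zero_single (k : ℕ) (v : Fin k) (I : Finset (Fin k)) (i : Fin k) :
    psiVI k v I 0 (Pi.single i 1) = if i ∈ I then 0 else (v : ℝ) - (i : ℝ) := by
  unfold psiVI
  rw [Finset.sum_eq_single i]
  · simp
  · intro b _ hb
    simp [hb]
  · simp

/-- If three reals, split into two classes, have zero sum on each class, then a nonzero one
shares its class with another nonzero one, and any two nonzero ones share a class. -/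
theorem class_iff_of_sum_ite_eq_zero {a b c : ℝ} {p q r : Prop}
    [Decidable p] [Decidable q] [Decidable r]
    (hin : (if p then a else 0) + (if q then b else 0) + (if r then c else 0) = 0)
    (hout : (if p then 0 else a) + (if q then 0 else b) + (if r then 0 else c) = 0)
    (ha : a ≠ 0) : (b ≠ 0 ∨ c ≠ 0) ∧ (b ≠ 0 → (p ↔ q)) ∧ (c ≠ 0 → (p ↔ r)) := by
  by_cases hp : p <;> by_cases hq : q <;> by_cases hr : r <;> simp_all <;> grind

/-- Non-generic case of three linear forms: if three distinct forms of Ψ satisfy a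
nontrivial linear relation c₁ψ₁ + c₂ψ₂ + c₃ψ₃ = 0 with c₁+c₂+c₃ = 0 and all cᵢ ≠ 0,
then they share a common set of variables. -/
theorem stmt2 (k : ℕ) (hk : 2 ≤ k)
    (v₁ v₂ v₃ : Fin k) (I₁ I₂ I₃ : Finset (Fin k))
    (hv₁ : v₁ ∈ I₁) (hv₂ : v₂ ∈ I₂) (hv₃ : v₃ ∈ I₃)
    (hd₁₂ : (v₁, I₁) ≠ (v₂, I₂)) (hd₁₃ : (v₁, I₁) ≠ (v₃, I₃)) (hd₂₃ : (v₂, I₂) ≠ (v₃, I₃))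
    (c₁ c₂ c₃ : ℝ) (hc₁ : c₁ ≠ 0) (hc₂ : c₂ ≠ 0) (hc₃ : c₃ ≠ 0)
    (hsum : c₁ + c₂ + c₃ = 0)
    (hlin : ∀ x y : Fin k → ℝ,
      c₁ * psiVI k v₁ I₁ x y + c₂ * psiVI k v₂ I₂ x y + c₃ * psiVI k v₃ I₃ x y = 0) :
    ∃ I : Finset (Fin k), I₁ = insert v₁ I ∧ I₂ = insert v₂ I ∧ I₃ = insert v₃ I := by
  have hin (i : Fin k) := hlin (Pi.single i 1) 0
  have hout (i : Fin k) := hlin 0 (Pi.single i 1)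
  simp only [psiVI_single_zero, psiVI_zero_single, mul_ite, mul_zero] at hin hout
  have hne {c : ℝ} (hc : c ≠ 0) (v i : Fin k) : c * ((v : ℝ) - (i : ℝ)) ≠ 0 ↔ v ≠ i := by
    simp [hc, sub_eq_zero, Fin.ext_iff]
  have key₁ (i : Fin k) (h : v₁ ≠ i) :
      (v₂ ≠ i ∨ v₃ ≠ i) ∧ (v₂ ≠ i → (i ∈ I₁ ↔ i ∈ I₂)) ∧ (v₃ ≠ i → (i ∈ I₁ ↔ i ∈ I₃)) := by
    simpa only [hne hc₂, hne hc₃] using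
      class_iff_of_sum_ite_eq_zero (hin i) (hout i) ((hne hc₁ v₁ i).2 h)
  have key₂ (i : Fin k) (h : v₂ ≠ i) :
      (v₃ ≠ i ∨ v₁ ≠ i) ∧ (v₃ ≠ i → (i ∈ I₂ ↔ i ∈ I₃)) ∧ (v₁ ≠ i → (i ∈ I₂ ↔ i ∈ I₁)) := by
    simpa only [hne hc₃, hne hc₁] using
      class_iff_of_sum_ite_eq_zero ((add_rotate _ _ _).symm.trans (hin i))
        ((add_rotate _ _ _).symm.trans (hout i)) ((hne hc₂ v₂ i).2 h)
  have key₃ (i : Fin k) (h : v₃ ≠ i) : v₁ ≠ i ∨ v₂ ≠ i := by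
    simpa only [hne hc₁, hne hc₂] using
      (class_iff_of_sum_ite_eq_zero ((add_rotate _ _ _).trans (hin i))
        ((add_rotate _ _ _).trans (hout i)) ((hne hc₃ v₃ i).2 h)).1
  have h₁₂ : v₁ ≠ v₂ := by
    rintro rfl
    by_cases h : v₃ = v₁
    · subst h
      refine hd₁₂ (Prod.ext rfl (Finset.ext fun i ↦ ?_))
      by_cases hi : v₃ = i
      · subst hi
        simp [hv₁, hv₂]
      · exact (key₁ i hi).2.1 hi
    · simpa using key₃ v₁ h
  have h₁₃ : v₁ ≠ v₃ := by
    rintro rfl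
    simpa using (key₂ v₁ h₁₂.symm).1
  have h₂₃ : v₂ ≠ v₃ := by
    rintro rfl
    simpa using (key₁ v₂ h₁₂).1
  refine ⟨(I₁ ∩ I₂) ∪ (I₁ ∩ I₃) ∪ (I₂ ∩ I₃), ?_, ?_, ?_⟩ <;>
  · ext i
    have := key₁ i
    have := key₂ i
    simp only [Finset.mem_insert, Finset.mem_union, Finset.mem_inter]
    grind
end

section
/- Let Ψ be the family of k·2^{k−1} forms ψ_j(s^{(ω)}) in 2k variables, where ψ_j(s_1,…,s_k) = Σ_i (j−i)s_i, for 1 ≤ j ≤ k and ω ∈ {0,1}^{[k]∖{j}}. Then L(Ψ) = (k−1)·2^{k−2}, where L(Ψ) = sup over partitions π of the index set with |π| < t of (t − |π|)/codim Π(Ψ,π), t = k·2^{k−1}, and Π(Ψ,π) is the linear subvariety on which forms in the same atom of π coincide. -/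
/-- The forms of Ψ are indexed by pairs (v, I) with v ∈ I ⊆ [k]; there are k·2^{k−1}
of them. -/
abbrev PsiIdx (k : ℕ) := {p : Fin k × Finset (Fin k) // p.1 ∈ p.2}

/-- ψ_{v,I}(x,y) = Σ_{i∈I}(v−i)x_i + Σ_{i∉I}(v−i)y_i as a linear map on ℝ^k × ℝ^k. -/
noncomputable def psiLin (k : ℕ) (v : Fin k) (I : Finset (Fin k)) :
    ((Fin k → ℝ) × (Fin k → ℝ)) →ₗ[ℝ] ℝ :=
  ∑ i : Fin k,
    if i ∈ I then
      ((v : ℝ) - (i : ℝ)) •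
        ((LinearMap.proj (R := ℝ) (φ := fun _ : Fin k => ℝ) i).comp
          (LinearMap.fst ℝ (Fin k → ℝ) (Fin k → ℝ)))
    else
      ((v : ℝ) - (i : ℝ)) •
        ((LinearMap.proj (R := ℝ) (φ := fun _ : Fin k => ℝ) i).comp
          (LinearMap.snd ℝ (Fin k → ℝ) (Fin k → ℝ)))

/-- Π(Ψ,π): the subspace where any two forms lying in the same atom of the partition π
coincide. -/
noncomputable def PiPart (k : ℕ) (π : Finpartition (Finset.univ : Finset (PsiIdx k))) :
    Submodule ℝ ((Fin k → ℝ) × (Fin k → ℝ)) :=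
  ⨅ P ∈ π.parts, ⨅ i ∈ P, ⨅ j ∈ P,
    LinearMap.ker (psiLin k i.val.1 i.val.2 - psiLin k j.val.1 j.val.2)

open Module Finset

/-- The space ℝ^k × ℝ^k on which the forms of Ψ live. -/
abbrev PairSpace (k : ℕ) := (Fin k → ℝ) × (Fin k → ℝ)

/-- The basis vector of ℝ^k × ℝ^k dual to the variable x_i. -/
def basisFst {k : ℕ} (i : Fin k) : PairSpace k := (Pi.single i 1, 0)

/-- The vector of ℝ^k × ℝ^k with x_i = y_i = 1 and all other coordinates zero. -/
def basisDiag {k : ℕ} (i : Fin k) : PairSpace k := (Pi.single i 1, Pi.single i 1)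

theorem psiLin_basisFst {k : ℕ} (v i : Fin k) (I : Finset (Fin k)) :
    psiLin k v I (basisFst i) = if i ∈ I then (v : ℝ) - (i : ℝ) else 0 := by
  rw [psiLin, LinearMap.sum_apply, Finset.sum_eq_single i]
  · by_cases h : i ∈ I <;> simp [h, basisFst]
  · intro j _ hj
    by_cases h : j ∈ I <;> simp [h, hj, basisFst]
  · simp

theorem psiLin_basisDiag {k : ℕ} (v i : Fin k) (I : Finset (Fin k)) :
    psiLin k v I (basisDiag i) = (v : ℝ) - (i : ℝ) := by
  rw [psiLin, LinearMap.sum_apply, Finset.sum_eq_single i]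
  · by_cases h : i ∈ I <;> simp [h, basisDiag]
  · intro j _ hj
    by_cases h : j ∈ I <;> simp [h, hj, basisDiag]
  · simp

theorem dual_eq_of_basis {k : ℕ} {f g : Dual ℝ (PairSpace k)}
    (h₁ : ∀ i, f (basisFst i) = g (basisFst i))
    (h₂ : ∀ i, f (basisDiag i) = g (basisDiag i)) : f = g := by
  have hs (i : Fin k) : ((0, Pi.single i 1) : PairSpace k) = basisDiag i - basisFst i := by
    simp [basisDiag, basisFst]
  refine LinearMap.prod_ext (LinearMap.pi_ext' fun i => ?_) (LinearMap.pi_ext' fun i => ?_)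
  · ext
    exact h₁ i
  · ext
    change f (0, Pi.single i 1) = g (0, Pi.single i 1)
    rw [hs, map_sub, map_sub, h₁, h₂]

theorem fin_cast_sub_ne_zero {k : ℕ} {v i : Fin k} (h : v ≠ i) : (v : ℝ) - (i : ℝ) ≠ 0 := by
  rw [sub_ne_zero]
  exact_mod_cast fun e => h (Fin.ext e)

theorem eq_of_psiLin_eq {k : ℕ} {v : Fin k} {I J : Finset (Fin k)} (hI : v ∈ I) (hJ : v ∈ J)
    (h : psiLin k v I - psiLin k v J = 0) : I = J := by
  ext i
  by_cases hi : v = i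
  · subst hi
    simp [hI, hJ]
  · have e := LinearMap.congr_fun h (basisFst i)
    rw [LinearMap.sub_apply, psiLin_basisFst, psiLin_basisFst, LinearMap.zero_apply] at e
    have := fin_cast_sub_ne_zero hi
    by_cases h₁ : i ∈ I <;> by_cases h₂ : i ∈ J <;>
      simp only [h₁, h₂, if_true, if_false] at e ⊢ <;> exact absurd (by linarith) this

/-- The linear forms that vanish on the diagonal of ℝ^k × ℝ^k. -/
def vanishDiag (k : ℕ) : Submodule ℝ (Dual ℝ (PairSpace k)) where
  carrier := {f | ∀ i, f (basisDiag i) = 0}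
  add_mem' hf hg i := by simp [hf i, hg i]
  zero_mem' i := by simp
  smul_mem' c f hf i := by simp [hf i]

/-- The linear forms that do not involve the variable x_i. -/
def vanishFst {k : ℕ} (i : Fin k) : Submodule ℝ (Dual ℝ (PairSpace k)) where
  carrier := {f | f (basisFst i) = 0}
  add_mem' {f g} hf hg := by
    change f _ = 0 at hf
    change g _ = 0 at hg
    simp [hf, hg]
  zero_mem' := by simp
  smul_mem' c f hf := by
    change f _ = 0 at hf
    simp [hf]

theorem mem_vanishDiag {k : ℕ} {f : Dual ℝ (PairSpace k)} :
    f ∈ vanishDiag k ↔ ∀ i, f (basisDiag i) = 0 := Iff.rfl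

theorem mem_vanishFst {k : ℕ} {f : Dual ℝ (PairSpace k)} {i : Fin k} :
    f ∈ vanishFst i ↔ f (basisFst i) = 0 := Iff.rfl

theorem sub_mem_vanishDiag_iff {k : ℕ} {v w : Fin k} {I J : Finset (Fin k)} :
    psiLin k v I - psiLin k w J ∈ vanishDiag k ↔ v = w := by
  constructor
  · intro h
    have e := h v
    rw [LinearMap.sub_apply, psiLin_basisDiag, psiLin_basisDiag] at e
    by_contra hne
    exact fin_cast_sub_ne_zero hne (by linarith)
  · rintro rfl i
    simp [psiLin_basisDiag]

theorem exists_basisFst_ne_zero {k : ℕ} {f : Dual ℝ (PairSpace k)} (hf : f ∈ vanishDiag k)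
    (h0 : f ≠ 0) : ∃ i, f (basisFst i) ≠ 0 := by
  by_contra! h
  exact h0 (dual_eq_of_basis (fun i => by simpa using h i) (fun i => by simpa using hf i))

theorem sub_mem_vanishFst_self {k : ℕ} (v : Fin k) (I J : Finset (Fin k)) :
    psiLin k v I - psiLin k v J ∈ vanishFst v := by
  simp [mem_vanishFst, psiLin_basisFst]

theorem sub_mem_vanishFst_of_notMem {k : ℕ} {v w m : Fin k} {I J : Finset (Fin k)}
    (hI : m ∉ I) (hJ : m ∉ J) : psiLin k v I - psiLin k w J ∈ vanishFst m := by
  simp [mem_vanishFst, psiLin_basisFst, hI, hJ]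

theorem card_supersets {k : ℕ} (v : Fin k) :
    (Icc ({v} : Finset (Fin k)) univ).card = 2 ^ (k - 1) := by
  rw [card_Icc_finset (subset_univ _)]
  simp

theorem card_supersets_erase {k : ℕ} {v m : Fin k} (h : v ≠ m) :
    (Icc ({v} : Finset (Fin k)) (univ.erase m)).card = 2 ^ (k - 2) := by
  rw [card_Icc_finset (by simpa using h)]
  simp [Nat.sub_sub]

theorem card_supersets_pair {k : ℕ} {v m : Fin k} (h : v ≠ m) :
    (Icc ({v, m} : Finset (Fin k)) univ).card = 2 ^ (k - 2) := by
  rw [card_Icc_finset (subset_univ _), card_pair h]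
  simp

theorem mem_supersets {k : ℕ} {v : Fin k} {I : Finset (Fin k)} :
    I ∈ Icc ({v} : Finset (Fin k)) univ ↔ v ∈ I := by
  simp [mem_Icc]

theorem mem_supersets_erase {k : ℕ} {v m : Fin k} {I : Finset (Fin k)} :
    I ∈ Icc ({v} : Finset (Fin k)) (univ.erase m) ↔ v ∈ I ∧ m ∉ I := by
  simp [mem_Icc, subset_erase]

theorem mem_supersets_pair {k : ℕ} {v m : Fin k} {I : Finset (Fin k)} :
    I ∈ Icc ({v, m} : Finset (Fin k)) univ ↔ v ∈ I ∧ m ∈ I := by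
  simp [mem_Icc, insert_subset_iff]

/-- The forms ψ_{v,I} with I ∈ A v are pairwise distinct modulo W. -/
def Separated {k : ℕ} (W : Submodule ℝ (Dual ℝ (PairSpace k)))
    (A : Fin k → Finset (Finset (Fin k))) : Prop :=
  (∀ v, ∀ I ∈ A v, v ∈ I) ∧
    ∀ v w, ∀ I ∈ A v, ∀ J ∈ A w, psiLin k v I - psiLin k w J ∈ W → v = w ∧ I = J

/-- The span of the differences of forms lying in the same atom of π. -/
noncomputable def diffSpan {k : ℕ} (π : Finpartition (univ : Finset (PsiIdx k))) :
    Submodule ℝ (Dual ℝ (PairSpace k)) :=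
  Submodule.span ℝ {g | ∃ P ∈ π.parts, ∃ i ∈ P, ∃ j ∈ P,
    g = psiLin k i.val.1 i.val.2 - psiLin k j.val.1 j.val.2}

theorem piPart_eq_dualCoannihilator {k : ℕ} (π : Finpartition (univ : Finset (PsiIdx k))) :
    PiPart k π = (diffSpan π).dualCoannihilator := by
  ext x
  rw [← SetLike.mem_coe, ← SetLike.mem_coe, diffSpan, Submodule.coe_dualCoannihilator_span]
  simp only [PiPart, SetLike.mem_coe, Submodule.mem_iInf, LinearMap.mem_ker, Set.mem_ofPred_eq]
  constructor
  · rintro h _ ⟨P, hP, i, hi, j, hj, rfl⟩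
    exact h P hP i hi j hj
  · intro h P hP i hi j hj
    exact h _ ⟨P, hP, i, hi, j, hj, rfl⟩

theorem finrank_diffSpan_add {k : ℕ} (π : Finpartition (univ : Finset (PsiIdx k))) :
    finrank ℝ (diffSpan π) + finrank ℝ (PiPart k π) = 2 * k := by
  rw [piPart_eq_dualCoannihilator]
  have := Subspace.finrank_add_finrank_dualCoannihilator_eq (diffSpan π)
  rw [this]
  simp [two_mul]

theorem Separated.sum_card_le {k : ℕ} {π : Finpartition (univ : Finset (PsiIdx k))}
    {A : Fin k → Finset (Finset (Fin k))} (hA : Separated (diffSpan π) A) :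
    ∑ v, (A v).card ≤ π.parts.card := by
  rw [← card_sigma]
  let F : (Σ _ : Fin k, Finset (Fin k)) → Finset (PsiIdx k) := fun p =>
    if h : p.1 ∈ p.2 then π.part ⟨(p.1, p.2), h⟩ else ∅
  refine card_le_card_of_injOn F ?_ ?_
  · rintro ⟨v, I⟩ h
    have hv : v ∈ I := hA.1 v I (by simpa using h)
    simp [F, hv]
  · rintro ⟨v, I⟩ h ⟨w, J⟩ h' e
    have hI : I ∈ A v := by simpa using h
    have hJ : J ∈ A w := by simpa using h'
    have hv := hA.1 v I hI
    have hw := hA.1 w J hJ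
    simp only [F, hv, hw, dif_pos] at e
    obtain ⟨rfl, rfl⟩ := hA.2 v w I hI J hJ (Submodule.subset_span
      ⟨_, π.part_mem.2 (mem_univ _), ⟨(v, I), hv⟩, π.mem_part (mem_univ _), ⟨(w, J), hw⟩,
        e ▸ π.mem_part (mem_univ _), rfl⟩)
    rfl

/-- If two pairs of forms differ by nonzero multiples of the same form and share their first
index v, the second index of the first pair constrains the set of the second pair. -/
theorem mem_iff_mem_of_sub_eq_smul {k : ℕ} {v u u' : Fin k} {I J I' J' : Finset (Fin k)}
    {f : Dual ℝ (PairSpace k)} {t t' : ℝ} (hu : v ≠ u) (hu' : v ≠ u')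
    (h : psiLin k v I - psiLin k u J = t • f)
    (h' : psiLin k v I' - psiLin k u' J' = t' • f) : u ∈ I' ↔ u ∈ I := by
  have e₁ := LinearMap.congr_fun h (basisFst u)
  have e₂ := LinearMap.congr_fun h (basisDiag u)
  have e₃ := LinearMap.congr_fun h' (basisFst u)
  have e₄ := LinearMap.congr_fun h' (basisDiag u)
  simp only [LinearMap.sub_apply, psiLin_basisFst, psiLin_basisDiag, LinearMap.smul_apply,
    smul_eq_mul] at e₁ e₂ e₃ e₄
  have n₁ := fin_cast_sub_ne_zero hu
  have n₂ := fin_cast_sub_ne_zero hu'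
  have ht : t ≠ 0 := by
    rintro rfl
    exact n₁ (by linarith)
  by_cases hI : u ∈ I
  · have ha : f (basisFst u) = f (basisDiag u) := by
      refine mul_left_cancel₀ ht ?_
      simp only [hI, if_true, sub_self, ite_self] at e₁
      linarith
    by_cases hI' : u ∈ I'
    · simp [hI, hI']
    · by_cases hJ' : u ∈ J' <;>
        simp only [hI', hJ', ha, if_true, if_false] at e₃
      · exact absurd (by linarith) n₁
      · exact absurd (by linarith) n₂
  · have ha : f (basisFst u) = 0 := by
      refine mul_left_cancel₀ ht ?_
      simp only [hI, if_false, sub_self, ite_self] at e₁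
      linarith
    by_cases hI' : u ∈ I'
    · by_cases hJ' : u ∈ J' <;>
        simp only [hI', hJ', ha, if_true, if_false, mul_zero] at e₃
      · exact absurd (by linarith) n₂
      · exact absurd (by linarith) n₁
    · simp [hI, hI']

theorem sum_ite_card {k : ℕ} (hk : 2 ≤ k) (v : Fin k) :
    ∑ w : Fin k, (if w = v then 2 ^ (k - 1) else 2 ^ (k - 2)) = (k + 1) * 2 ^ (k - 2) := by
  obtain ⟨n, rfl⟩ : ∃ n, k = n + 2 := ⟨k - 2, by omega⟩
  rw [← add_sum_erase _ _ (mem_univ v), if_pos rfl,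
    sum_congr rfl fun w hw => if_neg (ne_of_mem_erase hw)]
  simp [pow_succ]
  ring

theorem exists_generator_of_finrank_eq_one {V : Type*} [AddCommGroup V] [Module ℝ V]
    {W : Submodule ℝ V} (hW : finrank ℝ W = 1) :
    ∃ f ∈ W, f ≠ 0 ∧ ∀ g ∈ W, ∃ t : ℝ, g = t • f := by
  obtain ⟨⟨f, hfW⟩, hf0, hf⟩ := (finrank_eq_one_iff' (K := ℝ) (V := W)).1 hW
  refine ⟨f, hfW, by simpa using hf0, fun g hg => ?_⟩
  obtain ⟨t, ht⟩ := hf ⟨g, hg⟩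
  exact ⟨t, (congrArg Subtype.val ht).symm⟩

theorem exists_separated_of_finrank_eq_one {k : ℕ} (hk : 2 ≤ k)
    {W : Submodule ℝ (Dual ℝ (PairSpace k))} (hW : finrank ℝ W = 1) :
    ∃ A, Separated W A ∧ (k + 1) * 2 ^ (k - 2) ≤ ∑ v, (A v).card := by
  obtain ⟨f, -, hf0, hspan⟩ := exists_generator_of_finrank_eq_one hW
  by_cases hd : f ∈ vanishDiag k
  · obtain ⟨i, hi⟩ := exists_basisFst_ne_zero hd hf0
    have hzero : ∀ g ∈ W, g ∈ vanishFst i → g = 0 := by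
      intro g hg hgi
      obtain ⟨t, rfl⟩ := hspan g hg
      rw [mem_vanishFst] at hgi
      have : t = 0 := by simpa [hi] using hgi
      simp [this]
    refine ⟨fun v => if v = i then Icc {v} univ else Icc {v} (univ.erase i), ⟨?_, ?_⟩, ?_⟩
    · intro v I hI
      dsimp only at hI
      split_ifs at hI with h
      exacts [mem_supersets.1 hI, (mem_supersets_erase.1 hI).1]
    · intro v w I hI J hJ hmem
      have hvw : v = w := by
        obtain ⟨t, ht⟩ := hspan _ hmem
        exact sub_mem_vanishDiag_iff.1 (ht ▸ Submodule.smul_mem _ t hd)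
      subst hvw
      refine ⟨rfl, ?_⟩
      dsimp only at hI hJ
      by_cases h : v = i
      · subst h
        rw [if_pos rfl, mem_supersets] at hI hJ
        exact eq_of_psiLin_eq hI hJ (hzero _ hmem (sub_mem_vanishFst_self _ _ _))
      · rw [if_neg h, mem_supersets_erase] at hI hJ
        exact eq_of_psiLin_eq hI.1 hJ.1 (hzero _ hmem (sub_mem_vanishFst_of_notMem hI.2 hJ.2))
    · rw [← sum_ite_card hk i]
      refine sum_le_sum fun v _ => ?_
      dsimp only
      split_ifs with h
      · rw [card_supersets]
      · rw [card_supersets_erase h]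
  · have hzero : ∀ g ∈ W, g ∈ vanishDiag k → g = 0 := by
      intro g hg hgd
      obtain ⟨t, rfl⟩ := hspan g hg
      by_cases ht : t = 0
      · simp [ht]
      · exact absurd ((Submodule.smul_mem_iff _ ht).1 hgd) hd
    have hfree : ∀ v : Fin k, ∃ A : Finset (Finset (Fin k)), 2 ^ (k - 2) ≤ A.card ∧
        (∀ I ∈ A, v ∈ I) ∧
        ∀ I ∈ A, ∀ u, ∀ J, v ≠ u → psiLin k v I - psiLin k u J ∉ W := by
      intro v
      by_cases h : ∃ I u J, v ≠ u ∧ psiLin k v I - psiLin k u J ∈ W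
      · obtain ⟨I, u, J, hu, hmem⟩ := h
        obtain ⟨t, ht⟩ := hspan _ hmem
        by_cases hI : u ∈ I
        · refine ⟨_, (card_supersets_erase hu).ge,
            fun I' hI' => (mem_supersets_erase.1 hI').1, fun I' hI' u' J' hu' hmem' => ?_⟩
          obtain ⟨t', ht'⟩ := hspan _ hmem'
          exact (mem_supersets_erase.1 hI').2 ((mem_iff_mem_of_sub_eq_smul hu hu' ht ht').2 hI)
        · refine ⟨_, (card_supersets_pair hu).ge,
            fun I' hI' => (mem_supersets_pair.1 hI').1, fun I' hI' u' J' hu' hmem' => ?_⟩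
          obtain ⟨t', ht'⟩ := hspan _ hmem'
          exact hI ((mem_iff_mem_of_sub_eq_smul hu hu' ht ht').1 (mem_supersets_pair.1 hI').2)
      · push Not at h
        exact ⟨Icc {v} univ, by rw [card_supersets]; gcongr <;> omega,
          fun I hI => mem_supersets.1 hI, fun I _ u J hu => h I u J hu⟩
    choose A hcard hmem hsep using hfree
    let v₀ : Fin k := ⟨0, by omega⟩
    refine ⟨fun v => if v = v₀ then Icc {v} univ else A v, ⟨?_, ?_⟩, ?_⟩
    · intro v I hI
      dsimp only at hI
      split_ifs at hI
      exacts [mem_supersets.1 hI, hmem v I hI]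
    · intro v w I hI J hJ hmemW
      dsimp only at hI hJ
      have hvw : v = w := by
        by_contra hne
        by_cases hv : v = v₀
        · rw [if_neg fun h : w = v₀ => hne (hv.trans h.symm)] at hJ
          refine hsep w J hJ v I (Ne.symm hne) ?_
          rw [← neg_sub]
          exact W.neg_mem hmemW
        · rw [if_neg hv] at hI
          exact hsep v I hI w J hne hmemW
      subst hvw
      refine ⟨rfl, eq_of_psiLin_eq ?_ ?_ (hzero _ hmemW (sub_mem_vanishDiag_iff.2 rfl))⟩
      · split_ifs at hI
        exacts [mem_supersets.1 hI, hmem v I hI]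
      · split_ifs at hJ
        exacts [mem_supersets.1 hJ, hmem v J hJ]
    · rw [← sum_ite_card hk v₀]
      refine sum_le_sum fun v _ => ?_
      dsimp only
      split_ifs
      · rw [card_supersets]
      · exact hcard v

theorem separated_single {k : ℕ} {W : Submodule ℝ (Dual ℝ (PairSpace k))} {v : Fin k}
    (h : W ⊓ (vanishDiag k ⊓ vanishFst v) = ⊥) :
    Separated W fun w => if w = v then Icc {w} univ else ∅ := by
  refine ⟨fun w I hI => ?_, fun w w' I hI J hJ hmem => ?_⟩
  · dsimp only at hI
    split_ifs at hI
    · exact mem_supersets.1 hI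
    · simp at hI
  · dsimp only at hI hJ
    by_cases hw : w = v
    · by_cases hw' : w' = v
      · subst hw
        subst hw'
        rw [if_pos rfl, mem_supersets] at hI hJ
        refine ⟨rfl, eq_of_psiLin_eq hI hJ ?_⟩
        rw [← Submodule.mem_bot ℝ, ← h]
        exact ⟨hmem, sub_mem_vanishDiag_iff.2 rfl, sub_mem_vanishFst_self _ _ _⟩
      · simp [hw'] at hJ
    · simp [hw] at hI

theorem exists_vanishFst_of_finrank_eq_one {k : ℕ}
    {X : Submodule ℝ (Dual ℝ (PairSpace k))} {v : Fin k} (hX : finrank ℝ X = 1)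
    (hle : X ≤ vanishDiag k ⊓ vanishFst v) :
    ∃ m, v ≠ m ∧ ∀ g ∈ X, g ∈ vanishFst m → g = 0 := by
  obtain ⟨f, hfX, hf0, hspan⟩ := exists_generator_of_finrank_eq_one hX
  obtain ⟨m, hm⟩ := exists_basisFst_ne_zero (hle hfX).1 hf0
  refine ⟨m, ?_, fun g hg hgm => ?_⟩
  · rintro rfl
    exact hm (hle hfX).2
  · obtain ⟨t, rfl⟩ := hspan g hg
    rw [mem_vanishFst] at hgm
    have : t = 0 := by simpa [hm] using hgm
    simp [this]

theorem exists_separated_of_finrank_eq_two {k : ℕ} (hk : 2 ≤ k)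
    {W : Submodule ℝ (Dual ℝ (PairSpace k))} (hW : finrank ℝ W = 2) :
    ∃ A, Separated W A ∧ 2 ^ (k - 1) ≤ ∑ v, (A v).card := by
  by_cases hbot : ∃ v : Fin k, W ⊓ (vanishDiag k ⊓ vanishFst v) = ⊥
  · obtain ⟨v, hv⟩ := hbot
    refine ⟨_, separated_single hv, ?_⟩
    rw [← card_supersets v]
    refine le_trans (by simp) (single_le_sum (fun _ _ => Nat.zero_le _) (mem_univ v))
  push Not at hbot
  have hlt : ∀ i : Fin k, ∀ f ∈ W ⊓ vanishDiag k, f (basisFst i) ≠ 0 →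
      finrank ℝ ↥(W ⊓ (vanishDiag k ⊓ vanishFst i)) = 1 ∧ W ≤ vanishDiag k := by
    intro i f hf hfi
    have h₁ : W ⊓ (vanishDiag k ⊓ vanishFst i) < W ⊓ vanishDiag k :=
      lt_of_le_of_ne (inf_le_inf_left _ inf_le_left) fun h => hfi (h.ge hf).2.2
    have h₂ := Submodule.finrank_lt_finrank_of_lt h₁
    have h₃ : finrank ℝ ↥(W ⊓ vanishDiag k) ≤ finrank ℝ W :=
      Submodule.finrank_mono inf_le_left
    have h₄ := Submodule.one_le_finrank_iff.2 (hbot i)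
    refine ⟨by omega, ?_⟩
    rw [← inf_eq_left]
    exact Submodule.eq_of_le_of_finrank_eq inf_le_left (by omega)
  obtain ⟨f, hf, hf0⟩ := Submodule.exists_mem_ne_zero_of_ne_bot (hbot ⟨0, by omega⟩)
  obtain ⟨i, hi⟩ := exists_basisFst_ne_zero hf.2.1 hf0
  obtain ⟨g, hg, hg0⟩ := Submodule.exists_mem_ne_zero_of_ne_bot (hbot i)
  obtain ⟨j, hj⟩ := exists_basisFst_ne_zero hg.2.1 hg0
  have hij : i ≠ j := by
    rintro rfl
    exact hj hg.2.2
  obtain ⟨hri, hWd⟩ := hlt i f ⟨hf.1, hf.2.1⟩ hi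
  obtain ⟨hrj, -⟩ := hlt j g ⟨hg.1, hg.2.1⟩ hj
  have hex : ∀ v : Fin k, ∃ m, v = i ∨ v = j →
      v ≠ m ∧ ∀ g ∈ W ⊓ (vanishDiag k ⊓ vanishFst v), g ∈ vanishFst m → g = 0 := by
    intro v
    by_cases hv : v = i ∨ v = j
    · obtain ⟨m, hm⟩ := exists_vanishFst_of_finrank_eq_one (v := v)
        (by rcases hv with rfl | rfl <;> assumption) inf_le_right
      exact ⟨m, fun _ => hm⟩
    · exact ⟨v, fun h => absurd h hv⟩
  choose m hm using hex
  refine ⟨fun v => if v = i ∨ v = j then Icc {v} (univ.erase (m v)) else ∅, ⟨?_, ?_⟩, ?_⟩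
  · intro v I hI
    dsimp only at hI
    split_ifs at hI
    · exact (mem_supersets_erase.1 hI).1
    · simp at hI
  · intro v w I hI J hJ hmem
    obtain rfl : v = w := sub_mem_vanishDiag_iff.1 (hWd hmem)
    dsimp only at hI hJ
    by_cases hv : v = i ∨ v = j
    · rw [if_pos hv, mem_supersets_erase] at hI hJ
      exact ⟨rfl, eq_of_psiLin_eq hI.1 hJ.1 ((hm v hv).2 _
        ⟨hmem, hWd hmem, sub_mem_vanishFst_self _ _ _⟩
        (sub_mem_vanishFst_of_notMem hI.2 hJ.2))⟩
    · simp [hv] at hI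
  · refine le_trans ?_ (sum_le_sum_of_subset (subset_univ {i, j}))
    rw [sum_pair hij]
    simp only [true_or, or_true, if_true]
    rw [card_supersets_erase (hm i (Or.inl rfl)).1, card_supersets_erase (hm j (Or.inr rfl)).1,
      ← two_mul, ← pow_succ', show k - 2 + 1 = k - 1 by omega]

theorem sub_card_parts_le {k : ℕ} (hk : 2 ≤ k) (π : Finpartition (univ : Finset (PsiIdx k)))
    (hr : 1 ≤ finrank ℝ (diffSpan π)) :
    k * 2 ^ (k - 1) ≤ (k - 1) * 2 ^ (k - 2) * finrank ℝ (diffSpan π) + π.parts.card := by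
  obtain ⟨n, rfl⟩ : ∃ n, k = n + 2 := ⟨k - 2, by omega⟩
  simp only [Nat.add_sub_cancel, show n + 2 - 1 = n + 1 by omega]
  have hpow : 1 ≤ 2 ^ n := Nat.one_le_two_pow
  obtain h | h | h : finrank ℝ (diffSpan π) = 1 ∨ finrank ℝ (diffSpan π) = 2 ∨
      3 ≤ finrank ℝ (diffSpan π) := by omega
  · obtain ⟨A, hA, hle⟩ := exists_separated_of_finrank_eq_one hk h
    have := hle.trans hA.sum_card_le
    rw [h]
    simp only [Nat.add_sub_cancel] at this
    rw [pow_succ]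
    nlinarith
  · obtain ⟨A, hA, hle⟩ := exists_separated_of_finrank_eq_two hk h
    have := hle.trans hA.sum_card_le
    rw [h]
    simp only [show n + 2 - 1 = n + 1 by omega] at this
    rw [pow_succ] at this ⊢
    nlinarith
  · have hpos : 1 ≤ π.parts.card := by
      rw [Nat.one_le_iff_ne_zero, card_ne_zero]
      exact ⟨_, π.part_mem.2 (mem_univ ⟨(0, {0}), by simp⟩)⟩
    have hmul : (n + 1) * 2 ^ n * 3 ≤ (n + 1) * 2 ^ n * finrank ℝ (diffSpan π) :=
      Nat.mul_le_mul_left _ h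
    rcases Nat.eq_zero_or_pos n with rfl | hn
    · simp at hmul ⊢
      omega
    · rw [pow_succ]
      nlinarith

/-- Remove i₀ from the set of an index whose first entry is not i₀. -/
def eraseIdx {k : ℕ} (i₀ : Fin k) (p : PsiIdx k) : PsiIdx k :=
  if h : p.val.1 = i₀ then p else
    ⟨(p.val.1, p.val.2.erase i₀), mem_erase.2 ⟨h, p.property⟩⟩

/-- The partition whose atoms are the fibres of `eraseIdx`. -/
noncomputable def erasePartition {k : ℕ} (i₀ : Fin k) :
    Finpartition (univ : Finset (PsiIdx k)) :=
  open Classical in Finpartition.ofSetoid (Setoid.ker (eraseIdx i₀))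

theorem eraseIdx_eq_of_mem_erasePartition {k : ℕ} {i₀ : Fin k} {P : Finset (PsiIdx k)}
    (hP : P ∈ (erasePartition i₀).parts) {p q : PsiIdx k} (hp : p ∈ P) (hq : q ∈ P) :
    eraseIdx i₀ p = eraseIdx i₀ q := by
  classical
  rw [← (erasePartition i₀).part_eq_of_mem hP hp, erasePartition,
    Finpartition.mem_part_ofSetoid_iff_rel] at hq
  exact hq

theorem card_erasePartition_le {k : ℕ} (hk : 2 ≤ k) (i₀ : Fin k) :
    (erasePartition i₀).parts.card ≤ (k + 1) * 2 ^ (k - 2) := by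
  classical
  have hsum : ∑ v : Fin k, (if v = i₀ then Icc ({v} : Finset (Fin k)) univ
      else Icc {v} (univ.erase i₀)).card = (k + 1) * 2 ^ (k - 2) := by
    rw [← sum_ite_card hk i₀]
    refine sum_congr rfl fun v _ => ?_
    split_ifs with h
    · rw [card_supersets]
    · rw [card_supersets_erase h]
  rw [← hsum, ← card_sigma]
  have hne (P : Finset (PsiIdx k)) (hP : P ∈ (erasePartition i₀).parts) :
      ∃ p, p ∈ P := (erasePartition i₀).nonempty_of_mem_parts hP
  have : Nonempty (PsiIdx k) := ⟨⟨(i₀, {i₀}), by simp⟩⟩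
  choose! r hr using hne
  refine card_le_card_of_injOn
    (fun P => ⟨(eraseIdx i₀ (r P)).val.1, (eraseIdx i₀ (r P)).val.2⟩) ?_ ?_
  · intro P _
    have hmem := (r P).property
    simp only [coe_sigma, Set.mem_sigma_iff, coe_univ, Set.mem_univ, true_and, mem_coe]
    by_cases h : (r P).val.1 = i₀
    · rw [eraseIdx, dif_pos h, if_pos h]
      exact mem_supersets.2 hmem
    · rw [eraseIdx, dif_neg h, if_neg h]
      exact mem_supersets_erase.2 ⟨mem_erase.2 ⟨h, hmem⟩, notMem_erase _ _⟩
  · intro P hP Q hQ e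
    have he : eraseIdx i₀ (r P) = eraseIdx i₀ (r Q) := by
      simp only [Sigma.mk.injEq, heq_eq_eq] at e
      exact Subtype.ext (Prod.ext e.1 e.2)
    have hmem : r Q ∈ (erasePartition i₀).part (r P) := by
      rw [erasePartition, Finpartition.mem_part_ofSetoid_iff_rel]
      exact he
    rw [(erasePartition i₀).part_eq_of_mem hP (hr P hP)] at hmem
    rw [← (erasePartition i₀).part_eq_of_mem hP hmem,
      (erasePartition i₀).part_eq_of_mem hQ (hr Q hQ)]

theorem finrank_diffSpan_erasePartition {k : ℕ} (hk : 2 ≤ k) (i₀ : Fin k) :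
    finrank ℝ (diffSpan (erasePartition i₀)) = 1 := by
  have hle : diffSpan (erasePartition i₀) ≤
      vanishDiag k ⊓ ⨅ i ∈ univ.erase i₀, vanishFst i := by
    rw [diffSpan, Submodule.span_le]
    rintro _ ⟨P, hP, p, hp, q, hq, rfl⟩
    have e := eraseIdx_eq_of_mem_erasePartition hP hp hq
    obtain ⟨⟨v, I⟩, hI⟩ := p
    obtain ⟨⟨w, J⟩, hJ⟩ := q
    have hvw : v = w := by
      have := congrArg (fun p => p.val.1) e
      unfold eraseIdx at this
      split_ifs at this <;> exact this
    subst hvw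
    refine ⟨sub_mem_vanishDiag_iff.2 rfl, ?_⟩
    simp only [SetLike.mem_coe, Submodule.mem_iInf]
    intro i hi
    have hi : i ≠ i₀ := ne_of_mem_erase hi
    have hIJ : i ∈ I ↔ i ∈ J := by
      have := congrArg (fun p => i ∈ p.val.2) e
      unfold eraseIdx at this
      split_ifs at this <;> simpa [hi] using this
    simp [mem_vanishFst, psiLin_basisFst, hIJ]
  obtain ⟨v, hv⟩ : ∃ v : Fin k, v ≠ i₀ := by
    have : Nontrivial (Fin k) := Fin.nontrivial_iff_two_le.2 hk
    exact exists_ne i₀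
  have hvI : v ∈ univ.erase i₀ := mem_erase.2 ⟨hv, mem_univ _⟩
  let f := psiLin k v univ - psiLin k v (univ.erase i₀)
  have hfmem : f ∈ diffSpan (erasePartition i₀) := by
    classical
    refine Submodule.subset_span ⟨(erasePartition i₀).part ⟨(v, univ), mem_univ _⟩,
      (erasePartition i₀).part_mem.2 (mem_univ _), ⟨(v, univ), mem_univ _⟩,
      (erasePartition i₀).mem_part (mem_univ _), ⟨(v, univ.erase i₀), hvI⟩, ?_, rfl⟩
    rw [erasePartition, Finpartition.mem_part_ofSetoid_iff_rel]
    change eraseIdx i₀ _ = eraseIdx i₀ _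
    simp [eraseIdx, hv]
  have hfi : f (basisFst i₀) ≠ 0 := by
    simpa [f, psiLin_basisFst] using fin_cast_sub_ne_zero hv
  refine finrank_eq_one (⟨f, hfmem⟩ : diffSpan (erasePartition i₀)) ?_ ?_
  · intro h
    exact hfi (by rw [show f = 0 from congrArg Subtype.val h]; rfl)
  · rintro ⟨g, hg⟩
    refine ⟨g (basisFst i₀) / f (basisFst i₀), Subtype.ext (dual_eq_of_basis ?_ ?_)⟩
    · intro i
      by_cases hi : i = i₀
      · subst hi
        simp [hfi]
      · have hz : ∀ h ∈ diffSpan (erasePartition i₀), h (basisFst i) = 0 := fun h hh => by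
          have : h ∈ ⨅ i ∈ univ.erase i₀, vanishFst i := (hle hh).2
          simp only [Submodule.mem_iInf] at this
          exact this i (mem_erase.2 ⟨hi, mem_univ _⟩)
        simp [hz g hg, hz f hfmem]
    · intro i
      simp [(hle hg).1 i, (hle hfmem).1 i]

theorem codim_eq_finrank_diffSpan {k : ℕ} (π : Finpartition (univ : Finset (PsiIdx k))) :
    (2 * k : ℝ) - (finrank ℝ (PiPart k π) : ℝ) = finrank ℝ (diffSpan π) := by
  have h : (finrank ℝ (diffSpan π) : ℝ) + finrank ℝ (PiPart k π) = 2 * k := by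
    exact_mod_cast finrank_diffSpan_add π
  linarith


/-- L(Ψ) = (k−1)·2^{k−2} for the system Ψ of the t = k·2^{k−1} forms ψ_j(s^{(ω)}),
where L(Ψ) is the supremum over partitions π of [t] with |π| < t of
(t − |π|)/codim Π(Ψ,π), the codimension being taken inside ℝ^{2k}. -/
theorem stmt7 (k : ℕ) (hk : 2 ≤ k) :
    sSup {r : ℝ | ∃ π : Finpartition (Finset.univ : Finset (PsiIdx k)),
        π.parts.card < k * 2 ^ (k - 1) ∧
        r = ((k * 2 ^ (k - 1) : ℝ) - (π.parts.card : ℝ)) /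
            ((2 * k : ℝ) - (Module.finrank ℝ (PiPart k π) : ℝ))} =
      ((k : ℝ) - 1) * 2 ^ (k - 2) := by
  refine IsGreatest.csSup_eq ⟨?_, ?_⟩
  · let i₀ : Fin k := ⟨0, by omega⟩
    have hr := finrank_diffSpan_erasePartition hk i₀
    have hge := sub_card_parts_le hk (erasePartition i₀) hr.ge
    have hle := card_erasePartition_le hk i₀
    obtain ⟨n, rfl⟩ : ∃ n, k = n + 2 := ⟨k - 2, by omega⟩
    refine ⟨erasePartition i₀, ?_, ?_⟩
    · refine hle.trans_lt ?_
      have hpow : 1 ≤ 2 ^ n := Nat.one_le_two_pow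
      simp only [Nat.add_sub_cancel, show n + 2 - 1 = n + 1 by omega, pow_succ]
      nlinarith
    · rw [codim_eq_finrank_diffSpan, hr, Nat.cast_one, div_one]
      rw [hr] at hge
      simp only [Nat.add_sub_cancel, show n + 2 - 1 = n + 1 by omega, pow_succ] at hge hle ⊢
      have hcard : (erasePartition i₀).parts.card = (n + 3) * 2 ^ n := by nlinarith
      rw [hcard]
      push_cast
      ring
  · rintro _ ⟨π, -, rfl⟩
    rw [codim_eq_finrank_diffSpan]
    have hk' : (1 : ℝ) ≤ k := by exact_mod_cast (by omega : 1 ≤ k)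
    rcases Nat.eq_zero_or_pos (finrank ℝ (diffSpan π)) with h | h
    · rw [h, Nat.cast_zero, div_zero]
      exact mul_nonneg (by linarith) (by positivity)
    · rw [div_le_iff₀ (by exact_mod_cast h), sub_le_iff_le_add]
      have := sub_card_parts_le hk π h
      rw [show (k : ℝ) - 1 = (k - 1 : ℕ) by push_cast [show 1 ≤ k by omega]; ring]
      exact_mod_cast this
end
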